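/- Fix an integer ℓ > 2. Let λ be a node of the ladder crystal B(Λ0)^L, let k ≥ 1, and let i be the residue of the k-th ladder. Then the number of ladder normal i-boxes of λ lying on the k-th ladder equals the number of normal i-boxes of the regularization Rλ lying on the k-th ladder, and the number of ladder conormal i-boxes of λ on the k-th ladder equals the number of conormal i-boxes of Rλ on the k-th ladder. In particular, the ladder good (resp. ladder cogood) i-box of λ lies on the same ladder as the good (resp. cogood) i-box of Rλ. -/

import Mathlib

noncomputable section

/-!
Common combinatorial definitions: partitions (English notation, rows indexed from 1),
Young diagrams, hooks, rim hooks, ladders, residues, crystal operators (classical and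
ladder versions), locked boxes, regularization classes, dominance order.
-/

structure YPartition where
  part : ℕ → ℕ
  zero_at_zero : part 0 = 0
  antitone : ∀ i j : ℕ, 1 ≤ i → i ≤ j → part j ≤ part i
  eventually_zero : ∃ N : ℕ, ∀ i : ℕ, N ≤ i → part i = 0

namespace YPartition

/-- The set of boxes of the Young diagram of `μ` (row, column), both indices ≥ 1. -/
def cells (μ : YPartition) : Set (ℕ × ℕ) :=
  {p | 1 ≤ p.1 ∧ 1 ≤ p.2 ∧ p.2 ≤ μ.part p.1}

/-- The length of column `b`: the number of rows containing a box in column `b`. -/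
def colLen (μ : YPartition) (b : ℕ) : ℕ :=
  Nat.card {a : ℕ | 1 ≤ a ∧ b ≤ μ.part a}

/-- The arm of box `(a,b)`: boxes strictly to its right in its row. -/
def arm (μ : YPartition) (a b : ℕ) : ℕ := μ.part a - b

/-- The leg of box `(a,b)`: boxes strictly below it in its column. -/
def leg (μ : YPartition) (a b : ℕ) : ℕ := μ.colLen b - a

/-- The hook length of the box `(a,b)`: arm + leg + 1. -/
def hook (μ : YPartition) (a b : ℕ) : ℕ := (μ.part a - b) + (μ.colLen b - a) + 1

/-- The number of boxes of `μ`. -/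
def size (μ : YPartition) : ℕ := μ.cells.ncard

/-- The number of (nonzero) parts of `μ`. -/
def length (μ : YPartition) : ℕ := μ.colLen 1

/-- `μ` is an `(ℓ,0)`-JM partition: there are no boxes `(a,b)`, `(a,y)`, `(x,b)` with
`ℓ ∣ hook (a,b)` while `ℓ` divides neither `hook (a,y)` nor `hook (x,b)`. -/
def IsJM (ℓ : ℕ) (μ : YPartition) : Prop :=
  ¬ ∃ a b y x : ℕ, (a, b) ∈ μ.cells ∧ (a, y) ∈ μ.cells ∧ (x, b) ∈ μ.cells ∧
    ℓ ∣ μ.hook a b ∧ ¬ ℓ ∣ μ.hook a y ∧ ¬ ℓ ∣ μ.hook x b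

/-- Two boxes share an edge. -/
def BoxAdjacent (p q : ℕ × ℕ) : Prop :=
  (p.1 = q.1 ∧ (p.2 + 1 = q.2 ∨ q.2 + 1 = p.2)) ∨
  (p.2 = q.2 ∧ (p.1 + 1 = q.1 ∨ q.1 + 1 = p.1))

/-- A set of boxes is connected (via shared edges, inside the set). -/
def SetConnected (S : Set (ℕ × ℕ)) : Prop :=
  ∀ p ∈ S, ∀ q ∈ S,
    Relation.ReflTransGen (fun x y => x ∈ S ∧ y ∈ S ∧ BoxAdjacent x y) p q

/-- `S` contains no 2 × 2 square of boxes. -/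
def HasNoSquare (S : Set (ℕ × ℕ)) : Prop :=
  ¬ ∃ a b : ℕ, (a, b) ∈ S ∧ (a + 1, b) ∈ S ∧ (a, b + 1) ∈ S ∧ (a + 1, b + 1) ∈ S

/-- `S` is a removable `ℓ`-rim hook of `μ`: a connected set of `ℓ` boxes of `μ` with no
2 × 2 square whose removal leaves the Young diagram of a partition. -/
def IsRimHook (ℓ : ℕ) (μ : YPartition) (S : Set (ℕ × ℕ)) : Prop :=
  S ⊆ μ.cells ∧ S.ncard = ℓ ∧ SetConnected S ∧ HasNoSquare S ∧
    ∃ ν : YPartition, ν.cells = μ.cells \ S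

/-- `S` is contained in a single row. -/
def HorizontalHook (S : Set (ℕ × ℕ)) : Prop := ∃ a : ℕ, ∀ p ∈ S, p.1 = a

/-- `S` is contained in a single column. -/
def VerticalHook (S : Set (ℕ × ℕ)) : Prop := ∃ b : ℕ, ∀ p ∈ S, p.2 = b

/-- Two sets of boxes are adjacent when some box of one shares an edge with a box of the other. -/
def SetsAdjacent (R S : Set (ℕ × ℕ)) : Prop := ∃ p ∈ R, ∃ q ∈ S, BoxAdjacent p q

/-- An `ℓ`-core: a partition with no removable `ℓ`-rim hook. -/
def IsCore (ℓ : ℕ) (μ : YPartition) : Prop := ¬ ∃ S : Set (ℕ × ℕ), IsRimHook ℓ μ S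

/-- `p` and `q` lie on the same ladder: going down one column step the row increases
by `ℓ - 1`. -/
def SameLadder (ℓ : ℕ) (p q : ℕ × ℕ) : Prop :=
  (q.1 : ℤ) - (p.1 : ℤ) = ((ℓ : ℤ) - 1) * ((p.2 : ℤ) - (q.2 : ℤ))

/-- The index of the ladder through `p`: the ladder through `(k,1)` has index `k`. -/
def ladderIdx (ℓ : ℕ) (p : ℕ × ℕ) : ℕ := p.1 + (ℓ - 1) * (p.2 - 1)

/-- The residue of position `(a,b)` is `b - a` mod `ℓ`. -/
def res (ℓ : ℕ) (p : ℕ × ℕ) : ℕ := (((p.2 : ℤ) - (p.1 : ℤ)) % (ℓ : ℤ)).toNat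

/-- `p` is a removable box of `μ`. -/
def Removable (μ : YPartition) (p : ℕ × ℕ) : Prop :=
  1 ≤ p.1 ∧ p.2 = μ.part p.1 ∧ μ.part (p.1 + 1) < p.2

/-- `p` is an addable box of `μ`. -/
def Addable (μ : YPartition) (p : ℕ × ℕ) : Prop :=
  1 ≤ p.1 ∧ p.2 = μ.part p.1 + 1 ∧ (p.1 = 1 ∨ p.2 ≤ μ.part (p.1 - 1))

/-- The removable `i`-boxes of `μ`. -/
def RemovableRes (ℓ i : ℕ) (μ : YPartition) : Set (ℕ × ℕ) :=
  {p | Removable μ p ∧ res ℓ p = i}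

/-- The addable `i`-boxes of `μ`. -/
def AddableRes (ℓ i : ℕ) (μ : YPartition) : Set (ℕ × ℕ) :=
  {p | Addable μ p ∧ res ℓ p = i}

/-- Ladder reading order (reflexive): ladders left to right, top to bottom within a ladder.
`LadderLE ℓ p q` means `p` is read before (or equal to) `q`. -/
def LadderLE (ℓ : ℕ) (p q : ℕ × ℕ) : Prop :=
  ladderIdx ℓ p < ladderIdx ℓ q ∨ (ladderIdx ℓ p = ladderIdx ℓ q ∧ p.1 ≤ q.1)

/-- Strict ladder reading order. -/
def LadderLT (ℓ : ℕ) (p q : ℕ × ℕ) : Prop :=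
  ladderIdx ℓ p < ladderIdx ℓ q ∨ (ladderIdx ℓ p = ladderIdx ℓ q ∧ p.1 < q.1)

/-- Classical reading order (reflexive): rows from bottom to top.
`RowLE p q` means `p` is read before (or equal to) `q`. -/
def RowLE (p q : ℕ × ℕ) : Prop := q.1 ≤ p.1

/-- Given a reading order `le`, a set `Rem` of `-` marks and `Add` of `+` marks, a `-` at `p`
survives the cancellation of adjacent `-+` pairs iff every interval of the reading word
starting at `p` contains strictly more `-`'s than `+`'s. -/
def NormalIn (le : ℕ × ℕ → ℕ × ℕ → Prop) (Rem Add : Set (ℕ × ℕ)) (p : ℕ × ℕ) : Prop :=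
  p ∈ Rem ∧ ∀ q ∈ Rem ∪ Add, le p q →
    (Add ∩ {s | le p s ∧ le s q}).ncard < (Rem ∩ {s | le p s ∧ le s q}).ncard

/-- A `+` at `q` survives the cancellation of adjacent `-+` pairs iff every interval of the
reading word ending at `q` contains strictly more `+`'s than `-`'s. -/
def ConormalIn (le : ℕ × ℕ → ℕ × ℕ → Prop) (Rem Add : Set (ℕ × ℕ)) (q : ℕ × ℕ) : Prop :=
  q ∈ Add ∧ ∀ p ∈ Rem ∪ Add, le p q →
    (Rem ∩ {s | le p s ∧ le s q}).ncard < (Add ∩ {s | le p s ∧ le s q}).ncard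

/-- Ladder normal `i`-box. -/
def LadderNormal (ℓ i : ℕ) (μ : YPartition) (p : ℕ × ℕ) : Prop :=
  NormalIn (LadderLE ℓ) (RemovableRes ℓ i μ) (AddableRes ℓ i μ) p

/-- Ladder conormal `i`-box. -/
def LadderConormal (ℓ i : ℕ) (μ : YPartition) (p : ℕ × ℕ) : Prop :=
  ConormalIn (LadderLE ℓ) (RemovableRes ℓ i μ) (AddableRes ℓ i μ) p

/-- Normal `i`-box (classical signature). -/
def ClassNormal (ℓ i : ℕ) (μ : YPartition) (p : ℕ × ℕ) : Prop :=
  NormalIn RowLE (RemovableRes ℓ i μ) (AddableRes ℓ i μ) p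

/-- Conormal `i`-box (classical signature). -/
def ClassConormal (ℓ i : ℕ) (μ : YPartition) (p : ℕ × ℕ) : Prop :=
  ConormalIn RowLE (RemovableRes ℓ i μ) (AddableRes ℓ i μ) p

/-- `ε̂_i(μ)`: number of ladder normal `i`-boxes. -/
def hatEps (ℓ i : ℕ) (μ : YPartition) : ℕ := {p | LadderNormal ℓ i μ p}.ncard

/-- `φ̂_i(μ)`: number of ladder conormal `i`-boxes. -/
def hatPhi (ℓ i : ℕ) (μ : YPartition) : ℕ := {p | LadderConormal ℓ i μ p}.ncard

/-- `ε_i(μ)`: number of normal `i`-boxes. -/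
def eps (ℓ i : ℕ) (μ : YPartition) : ℕ := {p | ClassNormal ℓ i μ p}.ncard

/-- `φ_i(μ)`: number of conormal `i`-boxes. -/
def phi (ℓ i : ℕ) (μ : YPartition) : ℕ := {p | ClassConormal ℓ i μ p}.ncard

/-- The ladder good `i`-box: the leftmost `-` of the reduced ladder `i`-signature. -/
def LadderGood (ℓ i : ℕ) (μ : YPartition) (p : ℕ × ℕ) : Prop :=
  LadderNormal ℓ i μ p ∧ ∀ q, LadderNormal ℓ i μ q → LadderLE ℓ p q

/-- The ladder cogood `i`-box: the rightmost `+` of the reduced ladder `i`-signature. -/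
def LadderCogood (ℓ i : ℕ) (μ : YPartition) (p : ℕ × ℕ) : Prop :=
  LadderConormal ℓ i μ p ∧ ∀ q, LadderConormal ℓ i μ q → LadderLE ℓ q p

/-- The good `i`-box (classical). -/
def ClassGood (ℓ i : ℕ) (μ : YPartition) (p : ℕ × ℕ) : Prop :=
  ClassNormal ℓ i μ p ∧ ∀ q, ClassNormal ℓ i μ q → RowLE p q

/-- The cogood `i`-box (classical). -/
def ClassCogood (ℓ i : ℕ) (μ : YPartition) (p : ℕ × ℕ) : Prop :=
  ClassConormal ℓ i μ p ∧ ∀ q, ClassConormal ℓ i μ q → RowLE q p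

/-- The ladder crystal operator `f̂_i` as a relation: `mu = f̂_i lam ≠ 0`. -/
def HatF (ℓ i : ℕ) (lam mu : YPartition) : Prop :=
  ∃ p, LadderCogood ℓ i lam p ∧ mu.cells = insert p lam.cells

/-- The ladder crystal operator `ê_i` as a relation: `mu = ê_i lam ≠ 0`. -/
def HatE (ℓ i : ℕ) (lam mu : YPartition) : Prop :=
  ∃ p, LadderGood ℓ i lam p ∧ mu.cells = lam.cells \ {p}

/-- The classical crystal operator `f̃_i` as a relation: `mu = f̃_i lam ≠ 0`. -/
def TildeF (ℓ i : ℕ) (lam mu : YPartition) : Prop :=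
  ∃ p, ClassCogood ℓ i lam p ∧ mu.cells = insert p lam.cells

/-- The classical crystal operator `ẽ_i` as a relation: `mu = ẽ_i lam ≠ 0`. -/
def TildeE (ℓ i : ℕ) (lam mu : YPartition) : Prop :=
  ∃ p, ClassGood ℓ i lam p ∧ mu.cells = lam.cells \ {p}

/-- `n`-fold composition of a relation. -/
def RelIter {α : Type} (r : α → α → Prop) : ℕ → α → α → Prop
  | 0 => fun a b => a = b
  | n + 1 => fun a b => ∃ c, r a c ∧ RelIter r n c b

/-- The empty partition. -/
def emptyP : YPartition where
  part := fun _ => 0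
  zero_at_zero := rfl
  antitone := fun _ _ _ _ => le_rfl
  eventually_zero := ⟨0, fun _ _ => rfl⟩

/-- `μ` is a node of the ladder crystal `B(Λ₀)^L`: it is obtained from the empty
partition by finitely many applications of the operators `f̂_i`, `0 ≤ i < ℓ`. -/
def LadderNode (ℓ : ℕ) (μ : YPartition) : Prop :=
  Relation.ReflTransGen (fun a b => ∃ i : ℕ, i < ℓ ∧ HatF ℓ i a b) emptyP μ

/-- The type I locking condition at `(a,b)`: every unoccupied position on the ladder of
`(a,b)` lying below it has an unoccupied position directly above it. -/
def LadderClear (ℓ : ℕ) (μ : YPartition) (a b : ℕ) : Prop :=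
  ∀ c d : ℕ, 1 ≤ c → 1 ≤ d → SameLadder ℓ (a, b) (c, d) → a < c →
    (c, d) ∉ μ.cells → (c - 1, d) ∉ μ.cells

/-- Locked boxes of `μ`. -/
inductive Locked (ℓ : ℕ) (μ : YPartition) : ℕ × ℕ → Prop where
  | typeI_top : ∀ b : ℕ, (1, b) ∈ μ.cells → LadderClear ℓ μ 1 b → Locked ℓ μ (1, b)
  | typeI_up : ∀ a b : ℕ, (a + 1, b) ∈ μ.cells → Locked ℓ μ (a, b) →
      LadderClear ℓ μ (a + 1) b → Locked ℓ μ (a + 1, b)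
  | typeII : ∀ a b b' : ℕ, (a, b) ∈ μ.cells → b < b' → Locked ℓ μ (a, b') → Locked ℓ μ (a, b)

/-- Number of boxes of `μ` on the `k`-th ladder. -/
def ladderCount (ℓ : ℕ) (μ : YPartition) (k : ℕ) : ℕ :=
  (μ.cells ∩ {p | ladderIdx ℓ p = k}).ncard

/-- `lam` and `mu` lie in the same regularization class: they have the same number of
boxes on every ladder. -/
def SameRegClass (ℓ : ℕ) (lam mu : YPartition) : Prop :=
  ∀ k : ℕ, ladderCount ℓ lam k = ladderCount ℓ mu k

/-- The boxes of `μ` are top-justified on each ladder. -/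
def TopJustified (ℓ : ℕ) (μ : YPartition) : Prop :=
  ∀ p ∈ μ.cells, ∀ q : ℕ × ℕ, 1 ≤ q.1 → 1 ≤ q.2 →
    ladderIdx ℓ q = ladderIdx ℓ p → q.1 < p.1 → q ∈ μ.cells

/-- `mu = R lam`: the regularization of `lam`, obtained by moving every box of `lam` to
the topmost unoccupied positions of its ladder. -/
def IsRegularization (ℓ : ℕ) (lam mu : YPartition) : Prop :=
  SameRegClass ℓ lam mu ∧ TopJustified ℓ mu

/-- Dominance order on partitions. -/
def DomLE (lam mu : YPartition) : Prop :=
  ∀ j : ℕ, ∑ i ∈ Finset.Icc 1 j, lam.part i ≤ ∑ i ∈ Finset.Icc 1 j, mu.part i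

/-- All (positive) positions on the `k`-th ladder. -/
def LadderPositions (ℓ k : ℕ) : Set (ℕ × ℕ) :=
  {p | 1 ≤ p.1 ∧ 1 ≤ p.2 ∧ ladderIdx ℓ p = k}

/-- The set of locked boxes of `μ`. -/
def lockedCells (ℓ : ℕ) (μ : YPartition) : Set (ℕ × ℕ) := {p | Locked ℓ μ p}

/-- The number of unlocked boxes of `μ` on the `k`-th ladder. -/
def unlockedCount (ℓ : ℕ) (μ : YPartition) (k : ℕ) : ℕ :=
  ((μ.cells ∩ LadderPositions ℓ k) \ lockedCells ℓ μ).ncard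

/-- The diagram `S μ`: locked boxes stay put, and on each ladder the unlocked boxes are
moved into the lowest positions of that ladder not occupied by locked boxes. -/
def SCells (ℓ : ℕ) (μ : YPartition) : Set (ℕ × ℕ) :=
  lockedCells ℓ μ ∪
    {p | 1 ≤ p.1 ∧ 1 ≤ p.2 ∧ p ∉ lockedCells ℓ μ ∧
      ((LadderPositions ℓ (ladderIdx ℓ p) ∩ {q | p.1 < q.1}) \ lockedCells ℓ μ).ncard
        < unlockedCount ℓ μ (ladderIdx ℓ p)}

/-- `μ` is `ℓ`-regular: no part occurs `ℓ` or more times. -/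
def IsRegular (ℓ : ℕ) (μ : YPartition) : Prop :=
  ∀ a : ℕ, 1 ≤ a → 0 < μ.part (a + (ℓ - 1)) → μ.part (a + (ℓ - 1)) < μ.part a

/-- Removal of a single horizontal or vertical `ℓ`-rim hook. -/
def RemoveHV (ℓ : ℕ) (lam mu : YPartition) : Prop :=
  ∃ S : Set (ℕ × ℕ), IsRimHook ℓ lam S ∧ (HorizontalHook S ∨ VerticalHook S) ∧
    mu.cells = lam.cells \ S

/-- Condition (1): every removable `ℓ`-rim hook is horizontal or vertical. -/
def Cond1 (ℓ : ℕ) (μ : YPartition) : Prop :=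
  ∀ S : Set (ℕ × ℕ), IsRimHook ℓ μ S → HorizontalHook S ∨ VerticalHook S

/-- Condition (2): no vertical (resp. horizontal) `ℓ`-rim hook `R` of `μ` together with an
adjacent horizontal (resp. vertical) `ℓ`-rim hook `S` of `μ \ R` . -/
def Cond2 (ℓ : ℕ) (μ : YPartition) : Prop :=
  ¬ ∃ (R S : Set (ℕ × ℕ)) (ν : YPartition), IsRimHook ℓ μ R ∧ ν.cells = μ.cells \ R ∧
    IsRimHook ℓ ν S ∧ SetsAdjacent R S ∧
    ((VerticalHook R ∧ HorizontalHook S) ∨ (HorizontalHook R ∧ VerticalHook S))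

/-- A generalized `ℓ`-partition: conditions (1) and (2) hold after removing any sequence of
horizontal and vertical `ℓ`-rim hooks (including the empty sequence). -/
def IsGenLPartition (ℓ : ℕ) (lam : YPartition) : Prop :=
  ∀ mu : YPartition, Relation.ReflTransGen (RemoveHV ℓ) lam mu → Cond1 ℓ mu ∧ Cond2 ℓ mu

/-- The `t`-th row (from the top) of the bottom block of the decomposition
`(μ, r, s, ρ, σ)`: the number of values `v ∈ [1, s+1]` whose column block still reaches
row `t`; column block `v` consists of `σ_v·ℓ + (s+1−v)(ℓ−1)` rows of length `≥ v`. -/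
def bottomPart (ℓ s : ℕ) (σ : YPartition) (t : ℕ) : ℕ :=
  ((Finset.Icc 1 (s + 1)).filter fun v => t ≤ σ.part v * ℓ + (s + 1 - v) * (ℓ - 1)).card

/-- The `i`-th part of the partition corresponding to the data `(μ, r, s, ρ, σ)`. -/
def decompPart (ℓ : ℕ) (mu : YPartition) (r s : ℕ) (ρ σ : YPartition) (i : ℕ) : ℕ :=
  if i = 0 then 0
  else if i ≤ r + 1 then s + mu.part 1 + (r + 1 - i) * (ℓ - 1) + ρ.part i * ℓ
  else if i ≤ r + max mu.length 1 then s + mu.part (i - r)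
  else bottomPart ℓ s σ (i - (r + max mu.length 1))

/-- Admissibility of the decomposition data `(μ, r, s, ρ, σ)`. -/
def GoodData (ℓ : ℕ) (mu : YPartition) (r s : ℕ) (ρ σ : YPartition) : Prop :=
  IsCore ℓ mu ∧ mu.part 1 < mu.part 2 + (ℓ - 1) ∧ mu.colLen 1 < mu.colLen 2 + (ℓ - 1) ∧
  ρ.length ≤ r + 1 ∧ σ.length ≤ s + 1 ∧
  (mu.cells = ∅ → ρ.part (r + 1) = 0 ∨ σ.part (s + 1) = 0)

/-- `lam ≈ (μ, r, s, ρ, σ)`. -/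
def Decomposes (ℓ : ℕ) (lam mu : YPartition) (r s : ℕ) (ρ σ : YPartition) : Prop :=
  ∀ i : ℕ, lam.part i = decompPart ℓ mu r s ρ σ i

/-- Removal of a single `ℓ`-rim hook. -/
def RemoveHook (ℓ : ℕ) (lam mu : YPartition) : Prop :=
  ∃ S : Set (ℕ × ℕ), IsRimHook ℓ lam S ∧ mu.cells = lam.cells \ S

/-- `lam` has `ℓ`-core `nu` and `ℓ`-weight `w`. -/
def HasCoreAndWeight (ℓ : ℕ) (lam nu : YPartition) (w : ℕ) : Prop :=
  IsCore ℓ nu ∧ RelIter (RemoveHook ℓ) w lam nu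

/-- An L-partition. -/
def IsLPartition (ℓ : ℕ) (lam : YPartition) : Prop :=
  ¬ ∃ p : ℕ × ℕ, p ∈ lam.cells ∧ ℓ ∣ lam.hook p.1 p.2 ∧
    (lam.arm p.1 p.2 < (ℓ - 1) * lam.leg p.1 p.2 ∨
     lam.leg p.1 p.2 < (ℓ - 1) * lam.arm p.1 p.2)

end YPartition

open YPartition

/-! ### Abstract reduction of signatures -/

/-- A signature read compatibly with a level function, `+`'s before `-`'s on each level. -/
structure SigSys (le : ℕ × ℕ → ℕ × ℕ → Prop) (Rem Add : Set (ℕ × ℕ)) (L : ℕ × ℕ → ℤ)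
    (n k : ℤ) : Prop where
  npos : 0 < n
  finR : Rem.Finite
  finA : Add.Finite
  tot : ∀ p q, le p q ∨ le q p
  trans : ∀ p q r, le p q → le q r → le p r
  lvl : ∀ p ∈ Rem ∪ Add, ∀ q ∈ Rem ∪ Add, L p < L q → ¬ le q p
  strict : ∀ p ∈ Add, ∀ q ∈ Rem, L p = L q → ¬ le q p
  anti : ∀ p ∈ Rem, ∀ q ∈ Rem, L p = L q → le p q → le q p → p = q
  cong : ∀ p ∈ Rem ∪ Add, n ∣ L p - k

theorem SigSys.count {le : ℕ × ℕ → ℕ × ℕ → Prop} {Rem Add : Set (ℕ × ℕ)} {L : ℕ × ℕ → ℤ}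
    {n k : ℤ} (S : SigSys le Rem Add L n k) :
    {p | NormalIn le Rem Add p ∧ L p = k}.ncard =
    {j : ℕ | 1 ≤ j ∧ ∀ v : ℕ, 1 ≤ v → (Add ∩ {s | k < L s ∧ L s ≤ k + n * v}).ncard + j ≤
      (Rem ∩ {s | k ≤ L s ∧ L s < k + n * v}).ncard}.ncard := by
  have hn := S.npos
  set K : Set (ℕ × ℕ) := Rem ∩ {s | L s = k} with hK
  have finK : K.Finite := S.finR.subset Set.inter_subset_left
  set rk : ℕ × ℕ → ℕ := fun p => (K ∩ {q | le q p}).ncard with hrk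
  have hrefl : ∀ p, le p p := fun p => (S.tot p p).elim id id
  -- complementary counts
  have hcomp : ∀ p ∈ K, rk p + (K ∩ {q | le p q}).ncard = K.ncard + 1 := by
    intro p hp
    have h1 := Set.ncard_union_add_ncard_inter (K ∩ {q | le q p}) (K ∩ {q | le p q})
      (finK.subset Set.inter_subset_left) (finK.subset Set.inter_subset_left)
    have h2 : (K ∩ {q | le q p}) ∪ (K ∩ {q | le p q}) = K := by
      ext q
      have := S.tot p q
      simp only [Set.mem_union, Set.mem_inter_iff, Set.mem_ofPred_eq]
      tauto
    have h3 : (K ∩ {q | le q p}) ∩ (K ∩ {q | le p q}) = {p} := by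
      ext q
      simp only [Set.mem_inter_iff, Set.mem_ofPred_eq, Set.mem_singleton_iff]
      constructor
      · rintro ⟨⟨hq, h4⟩, _, h5⟩
        exact S.anti q hq.1 p hp.1 (hq.2.trans hp.2.symm) h4 h5
      · rintro rfl
        exact ⟨⟨hp, hrefl _⟩, hp, hrefl _⟩
    rw [h2, h3, Set.ncard_singleton] at h1
    exact h1.symm
  have hpos : ∀ p ∈ K, 1 ≤ rk p := by
    intro p hp
    exact (Set.ncard_pos (finK.subset Set.inter_subset_left)).2 ⟨p, hp, hrefl p⟩
  have hle : ∀ p ∈ K, rk p ≤ K.ncard := fun p hp =>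
    Set.ncard_le_ncard Set.inter_subset_left finK
  have hinj : ∀ p ∈ K, ∀ q ∈ K, le p q → rk p = rk q → p = q := by
    intro p hp q hq hpq h
    have hsub : K ∩ {x | le x p} ⊆ K ∩ {x | le x q} := fun x hx =>
      ⟨hx.1, S.trans _ _ _ hx.2 hpq⟩
    have := Set.eq_of_subset_of_ncard_le hsub h.ge (finK.subset Set.inter_subset_left)
    have hq' : q ∈ K ∩ {x | le x p} := by
      rw [this]
      exact ⟨hq, hrefl q⟩
    exact S.anti p hp.1 q hq.1 (hp.2.trans hq.2.symm) hpq hq'.2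
  have hinjOn : Set.InjOn rk K := by
    intro p hp q hq h
    rcases S.tot p q with h1 | h1
    · exact hinj p hp q hq h1 h
    · exact (hinj q hq p hp h1 h.symm).symm
  have himg : Set.image rk K = Set.Icc 1 K.ncard := by
    apply Set.eq_of_subset_of_ncard_le
    · rintro _ ⟨p, hp, rfl⟩
      exact ⟨hpos p hp, hle p hp⟩
    · rw [Set.InjOn.ncard_image hinjOn]
      rw [Set.ncard_eq_toFinset_card']
      simp
    · exact Set.finite_Icc _ _
  -- splitting R(v)
  have hsplit : ∀ v : ℕ, 1 ≤ v → (Rem ∩ {s | k ≤ L s ∧ L s < k + n * v}).ncard =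
      K.ncard + (Rem ∩ {s | k < L s ∧ L s < k + n * v}).ncard := by
    intro v hv
    have hv' : 0 < n * v := by positivity
    rw [← Set.ncard_union_eq _ finK (S.finR.subset Set.inter_subset_left)]
    · congr 1
      ext s
      simp only [hK, Set.mem_union, Set.mem_inter_iff, Set.mem_ofPred_eq]
      constructor
      · rintro ⟨h1, h2, h3⟩
        rcases h2.eq_or_lt with h | h
        · exact Or.inl ⟨h1, h.symm⟩
        · exact Or.inr ⟨h1, h, h3⟩
      · rintro (⟨h1, h2⟩ | ⟨h1, h2, h3⟩)
        · exact ⟨h1, h2.ge, by omega⟩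
        · exact ⟨h1, h2.le, h3⟩
    · rw [Set.disjoint_left]
      intro s h1 h2
      have := h1.2
      have := h2.2.1
      simp only [Set.mem_ofPred_eq] at *
      omega
  -- characterization of normality
  have hnorm : ∀ p ∈ K, (NormalIn le Rem Add p ↔ ∀ v : ℕ, 1 ≤ v →
      (Add ∩ {s | k < L s ∧ L s ≤ k + n * v}).ncard + rk p ≤
      (Rem ∩ {s | k ≤ L s ∧ L s < k + n * v}).ncard) := by
    intro p hp
    have hpL : L p = k := hp.2
    have hc := hcomp p hp
    constructor
    · rintro ⟨-, hN⟩ v hv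
      rw [hsplit v hv]
      rcases (Add ∩ {s | k < L s ∧ L s ≤ k + n * v}).eq_empty_or_nonempty with he | hne
      · rw [he, Set.ncard_empty]
        have := hle p hp
        omega
      · have hfin : (Add ∩ {s | k < L s ∧ L s ≤ k + n * v}).Finite :=
          S.finA.subset Set.inter_subset_left
        obtain ⟨q, hq, hqmax⟩ : ∃ q ∈ Add ∩ {s | k < L s ∧ L s ≤ k + n * v},
            ∀ x ∈ Add ∩ {s | k < L s ∧ L s ≤ k + n * v}, le x q := by
          have : ∀ T : Set (ℕ × ℕ), T.Finite → T.Nonempty → ∃ q ∈ T, ∀ x ∈ T, le x q := by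
            intro T hT
            induction T, hT using Set.Finite.induction_on with
            | empty => intro h; exact absurd h (by simp)
            | @insert a T ha hT ih =>
              intro _
              rcases T.eq_empty_or_nonempty with rfl | hTn
              · exact ⟨a, by simp, by simpa using hrefl a⟩
              · obtain ⟨q, hq, h⟩ := ih hTn
                rcases S.tot a q with h1 | h1
                · refine ⟨q, Or.inr hq, ?_⟩
                  rintro x (rfl | hx)
                  · exact h1
                  · exact h x hx
                · refine ⟨a, Or.inl rfl, ?_⟩
                  rintro x (rfl | hx)
                  · exact hrefl _
                  · exact S.trans _ _ _ (h x hx) h1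
          exact this _ hfin hne
        obtain ⟨hqA, hq1, hq2⟩ := hq
        have hle_of_lt : ∀ x ∈ Rem ∪ Add, ∀ y ∈ Rem ∪ Add, L x < L y → le x y :=
          fun x hx y hy h => (S.tot x y).resolve_right (S.lvl x hx y hy h)
        have h := hN q (Or.inr hqA) (hle_of_lt p (Or.inl hp.1) q (Or.inr hqA) (by omega))
        have h1 : (Add ∩ {s | k < L s ∧ L s ≤ k + n * v}).ncard ≤
            (Add ∩ {s | le p s ∧ le s q}).ncard := by
          apply Set.ncard_le_ncard _ (S.finA.subset Set.inter_subset_left)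
          intro x hx
          exact ⟨hx.1, hle_of_lt p (Or.inl hp.1) x (Or.inr hx.1) (by
            have := hx.2.1
            omega), hqmax x hx⟩
        have h2 : (Rem ∩ {s | le p s ∧ le s q}).ncard ≤
            ((K ∩ {q | le p q}) ∪ (Rem ∩ {s | k < L s ∧ L s < k + n * v})).ncard := by
          apply Set.ncard_le_ncard _ ((finK.subset Set.inter_subset_left).union
            (S.finR.subset Set.inter_subset_left))
          rintro x ⟨hxR, hx1, hx2⟩
          have h3 : ¬ L x < L p := fun h => S.lvl x (Or.inl hxR) p (Or.inl hp.1) h hx1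
          have h4 : ¬ L q < L x := fun h => S.lvl q (Or.inr hqA) x (Or.inl hxR) h hx2
          have h5 : L q ≠ L x := fun h => S.strict q hqA x hxR h hx2
          by_cases h6 : L x = k
          · exact Or.inl ⟨⟨hxR, h6⟩, hx1⟩
          · exact Or.inr ⟨hxR, by omega, by omega⟩
        have h3 := Set.ncard_union_le (K ∩ {q | le p q})
          (Rem ∩ {s | k < L s ∧ L s < k + n * v})
        omega
    · intro hv
      refine ⟨hp.1, fun q hq hpq => ?_⟩
      have h3 : ¬ L q < L p := fun h => S.lvl q hq p (Or.inl hp.1) h hpq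
      have hAdd : ∀ x ∈ Add ∩ {s | le p s ∧ le s q}, k < L x ∧ L x ≤ L q := by
        rintro x ⟨hxA, hx1, hx2⟩
        have h4 : ¬ L x < L p := fun h => S.lvl x (Or.inr hxA) p (Or.inl hp.1) h hx1
        have h5 : L x ≠ L p := fun h => S.strict x hxA p hp.1 h hx1
        have h6 : ¬ L q < L x := fun h => S.lvl q hq x (Or.inr hxA) h hx2
        omega
      by_cases hqk : L q = k
      · have : Add ∩ {s | le p s ∧ le s q} = ∅ := by
          rw [Set.eq_empty_iff_forall_notMem]
          intro x hx
          have := hAdd x hx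
          omega
        rw [this, Set.ncard_empty]
        exact (Set.ncard_pos (S.finR.subset Set.inter_subset_left)).2 ⟨p, hp.1, hrefl p, hpq⟩
      · obtain ⟨w, hw⟩ := S.cong q hq
        have hwpos : 0 < w := by
          by_contra hcon
          have : n * w ≤ 0 := mul_nonpos_of_nonneg_of_nonpos hn.le (by omega)
          omega
        lift w to ℕ using hwpos.le
        have h := hv w (by omega)
        rw [hsplit w (by omega)] at h
        have h1 : (Add ∩ {s | le p s ∧ le s q}).ncard ≤
            (Add ∩ {s | k < L s ∧ L s ≤ k + n * w}).ncard := by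
          apply Set.ncard_le_ncard _ (S.finA.subset Set.inter_subset_left)
          intro x hx
          have := hAdd x hx
          exact ⟨hx.1, by omega, by omega⟩
        have h2 : ((K ∩ {q | le p q}) ∪ (Rem ∩ {s | k < L s ∧ L s < k + n * w})).ncard ≤
            (Rem ∩ {s | le p s ∧ le s q}).ncard := by
          apply Set.ncard_le_ncard _ (S.finR.subset Set.inter_subset_left)
          rintro x (⟨hxK, hx⟩ | ⟨hxR, hx1, hx2⟩)
          · refine ⟨hxK.1, hx, (S.tot x q).resolve_right (S.lvl x (Or.inl hxK.1) q hq ?_)⟩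
            have : L x = k := hxK.2
            omega
          · exact ⟨hxR, (S.tot p x).resolve_right (S.lvl p (Or.inl hp.1) x (Or.inl hxR)
              (by omega)), (S.tot x q).resolve_right (S.lvl x (Or.inl hxR) q hq (by omega))⟩
        rw [Set.ncard_union_eq _ (finK.subset Set.inter_subset_left)
          (S.finR.subset Set.inter_subset_left)] at h2
        · omega
        · rw [Set.disjoint_left]
          rintro x ⟨⟨_, h5⟩, _⟩ ⟨_, h6, _⟩
          simp only [Set.mem_ofPred_eq] at h5
          omega
  have hfinal : Set.image rk {p | NormalIn le Rem Add p ∧ L p = k} =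
      {j : ℕ | 1 ≤ j ∧ ∀ v : ℕ, 1 ≤ v → (Add ∩ {s | k < L s ∧ L s ≤ k + n * v}).ncard + j ≤
      (Rem ∩ {s | k ≤ L s ∧ L s < k + n * v}).ncard} := by
    ext j
    constructor
    · rintro ⟨p, ⟨hp, hpk⟩, rfl⟩
      have hpK : p ∈ K := ⟨hp.1, hpk⟩
      exact ⟨hpos p hpK, (hnorm p hpK).1 hp⟩
    · rintro ⟨hj, h⟩
      have hjK : j ≤ K.ncard := by
        have h1 := h 1 le_rfl
        rw [hsplit 1 le_rfl] at h1
        have : Rem ∩ {s | k < L s ∧ L s < k + n * (1 : ℕ)} = ∅ := by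
          rw [Set.eq_empty_iff_forall_notMem]
          rintro x ⟨hx, hx1, hx2⟩
          have h2 := Int.le_of_dvd (by omega) (S.cong x (Or.inl hx))
          push_cast at hx2
          omega
        rw [this, Set.ncard_empty] at h1
        omega
      have : j ∈ Set.image rk K := by
        rw [himg]
        exact ⟨hj, hjK⟩
      obtain ⟨p, hp, rfl⟩ := this
      exact ⟨p, ⟨(hnorm p hp).2 h, hp.2⟩, rfl⟩
  have hsub : {p | NormalIn le Rem Add p ∧ L p = k} ⊆ K := fun p hp => ⟨hp.1.1, hp.2⟩
  rw [← hfinal, Set.InjOn.ncard_image (hinjOn.mono hsub)]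

/-! ### Nodes of the ladder crystal contain no bad hooks -/

/-- There is no box `(a,d)` with arm `t ≥ 1` and hook length `ℓ t` (where `ℓ = e + 1`). -/
def NoBad (e : ℕ) (μ : YPartition) : Prop :=
  ∀ a d t : ℕ, 1 ≤ a → 1 ≤ d → 1 ≤ t → μ.part a = d + t → d ≤ μ.part (a + e * t - 1) →
    d ≤ μ.part (a + e * t)

theorem lidx (e : ℕ) (p : ℕ × ℕ) (h : 1 ≤ p.2) : 
    (ladderIdx (e + 1) p : ℤ) = p.1 + e * (p.2 - 1) := by
  unfold ladderIdx
  push_cast [Nat.cast_sub h]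
  simp

theorem res_eq_iff (ℓ : ℕ) (hℓ : 0 < ℓ) (p q : ℕ × ℕ) :
    res ℓ p = res ℓ q ↔ (ℓ : ℤ) ∣ ((p.2 : ℤ) - p.1) - (q.2 - q.1) := by
  unfold res
  have h1 := Int.emod_nonneg ((p.2 : ℤ) - p.1) (b := (ℓ : ℤ)) (by omega)
  have h2 := Int.emod_nonneg ((q.2 : ℤ) - q.1) (b := (ℓ : ℤ)) (by omega)
  rw [← Int.emod_eq_emod_iff_emod_sub_eq_zero.trans (Int.dvd_iff_emod_eq_zero).symm]
  omega

theorem res_ladder (e : ℕ) (p q : ℕ × ℕ) (hp : 1 ≤ p.2) (hq : 1 ≤ q.2) :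
    res (e + 1) p = res (e + 1) q ↔
      ((e + 1 : ℕ) : ℤ) ∣ (ladderIdx (e + 1) p : ℤ) - ladderIdx (e + 1) q := by
  rw [res_eq_iff _ (by omega), lidx e p hp, lidx e q hq]
  have : ((p.1 : ℤ) + e * (p.2 - 1)) - (q.1 + e * (q.2 - 1)) =
    ((e + 1 : ℕ) : ℤ) * (p.2 - q.2) - ((((p.2 : ℤ) - p.1) - (q.2 - q.1))) := by
    push_cast
    ring
  rw [this, dvd_sub_right (dvd_mul_right _ _)]

theorem rem_two {μ : YPartition} {p : ℕ × ℕ} (h : Removable μ p) : 1 ≤ p.2 := by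
  have := h.2.2
  omega

theorem add_two {μ : YPartition} {p : ℕ × ℕ} (h : Addable μ p) : 1 ≤ p.2 := by
  have := h.2.1
  omega

theorem finite_rem (μ : YPartition) : {p | Removable μ p}.Finite := by
  obtain ⟨N, hN⟩ := μ.eventually_zero
  apply ((Set.finite_Iio N).image (fun a => (a, μ.part a))).subset
  rintro ⟨a, b⟩ ⟨h1, h2, h3⟩
  simp only at h1 h2 h3
  refine ⟨a, ?_, by rw [h2]⟩
  by_contra hcon
  have := hN a (by simpa using hcon)
  omega

theorem finite_add (μ : YPartition) : {p | Addable μ p}.Finite := by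
  obtain ⟨N, hN⟩ := μ.eventually_zero
  apply ((Set.finite_Iio (N + 2)).image (fun a => (a, μ.part a + 1))).subset
  rintro ⟨a, b⟩ ⟨h1, h2, h3⟩
  simp only at h1 h2 h3
  refine ⟨a, ?_, by rw [h2]⟩
  by_contra hcon
  have hcon' : N + 2 ≤ a := by simpa using hcon
  have := hN (a - 1) (by omega)
  omega

/-- On one ladder an occupied row index determines the position. -/
theorem ladder_diff {e : ℕ} {p q : ℕ × ℕ} (hp : 1 ≤ p.2) (hq : 1 ≤ q.2)
    (h : ladderIdx (e + 1) p = ladderIdx (e + 1) q) (he : 1 ≤ e) (hle : p.1 ≤ q.1) :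
    ∃ t, p.2 = q.2 + t ∧ q.1 = p.1 + e * t := by
  have h1 := lidx e p hp
  have h2 := lidx e q hq
  have h3 : (q.1 : ℤ) = p.1 + e * ((p.2 : ℤ) - q.2) := by
    have : (ladderIdx (e + 1) p : ℤ) = ladderIdx (e + 1) q := by exact_mod_cast h
    linarith
  have h4 : (q.2 : ℤ) ≤ p.2 := by
    by_contra hcon
    have : (e : ℤ) * ((p.2 : ℤ) - q.2) < 0 :=
      mul_neg_of_pos_of_neg (by omega) (by omega)
    omega
  obtain ⟨t, ht⟩ := Nat.exists_eq_add_of_le (show q.2 ≤ p.2 by exact_mod_cast h4)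
  refine ⟨t, ht, ?_⟩
  rw [ht] at h3
  push_cast at h3
  have : (e : ℤ) * ((q.2 : ℤ) + t - q.2) = e * t := by ring
  rw [this] at h3
  exact_mod_cast h3

theorem NoBad.strict {e : ℕ} (he : 1 ≤ e) {μ : YPartition} (h : NoBad e μ) {p q : ℕ × ℕ}
    (hp : Removable μ p) (hq : Addable μ q)
    (hL : ladderIdx (e + 1) p = ladderIdx (e + 1) q) : q.1 < p.1 := by
  by_contra hcon
  obtain ⟨t, h1, h2⟩ := ladder_diff (rem_two hp) (add_two hq) hL he (by omega)
  obtain ⟨a, b⟩ := p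
  obtain ⟨c, d⟩ := q
  obtain ⟨hp1, hp2, hp3⟩ := hp
  obtain ⟨hq1, hq2, hq3⟩ := hq
  simp only at *
  rcases Nat.eq_zero_or_pos t with rfl | ht
  · simp only [mul_zero, add_zero] at h1 h2
    subst h1 h2
    omega
  · have h3 : 1 ≤ e * t := Nat.mul_pos he ht
    subst h2
    have h4 := h a d t hp1 (by omega) ht (by omega) (by omega)
    omega

theorem cogood_aux {ℓ i : ℕ} {μ : YPartition} {p s : ℕ × ℕ} (hp : LadderCogood ℓ i μ p)
    (hs : s ∈ AddableRes ℓ i μ) (hps : LadderLE ℓ p s) (hsp : ¬ LadderLE ℓ s p)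
    (hno : ∀ x ∈ RemovableRes ℓ i μ, LadderLE ℓ p x → LadderLE ℓ x s → False) : False := by
  have tot : ∀ p q, LadderLE ℓ p q ∨ LadderLE ℓ q p := by
    intro p q
    unfold LadderLE
    omega
  have trans : ∀ p q r, LadderLE ℓ p q → LadderLE ℓ q r → LadderLE ℓ p r := by
    intro p q r
    unfold LadderLE
    omega
  have finR : (RemovableRes ℓ i μ).Finite := (finite_rem μ).subset fun x hx => hx.1
  have finA : (AddableRes ℓ i μ).Finite := (finite_add μ).subset fun x hx => hx.1
  apply hsp
  apply hp.2
  refine ⟨hs, fun x hx hxs => ?_⟩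
  rcases tot p x with hpx | hxp
  · have : RemovableRes ℓ i μ ∩ {y | LadderLE ℓ x y ∧ LadderLE ℓ y s} = ∅ := by
      rw [Set.eq_empty_iff_forall_notMem]
      rintro y ⟨h1, h2, h3⟩
      exact hno y h1 (trans _ _ _ hpx h2) h3
    rw [this, Set.ncard_empty]
    exact (Set.ncard_pos (finA.subset Set.inter_subset_left)).2
      ⟨s, hs, hxs, (tot s s).elim id id⟩
  · have h := hp.1.2 x hx hxp
    refine lt_of_le_of_lt ?_ (lt_of_lt_of_le h ?_)
    · apply Set.ncard_le_ncard _ (finR.subset Set.inter_subset_left)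
      rintro y ⟨h1, h2, h3⟩
      refine ⟨h1, h2, (tot p y).resolve_left fun h4 => hno y h1 h4 h3⟩
    · apply Set.ncard_le_ncard _ (finA.subset Set.inter_subset_left)
      rintro y ⟨h1, h2, h3⟩
      exact ⟨h1, h2, trans _ _ _ h3 hps⟩

theorem part_insert {lam mu : YPartition} {p : ℕ × ℕ} (hp : Addable lam p)
    (h : mu.cells = insert p lam.cells) :
    mu.part p.1 = lam.part p.1 + 1 ∧ ∀ a, a ≠ p.1 → mu.part a = lam.part a := by
  obtain ⟨r, c⟩ := p
  obtain ⟨h1, h2, h3⟩ := hp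
  simp only at *
  have key : ∀ a b, 1 ≤ a → 1 ≤ b → (b ≤ mu.part a ↔ (a = r ∧ b = c) ∨ b ≤ lam.part a) := by
    intro a b ha hb
    have := Set.ext_iff.1 h (a, b)
    simp only [cells, Set.mem_ofPred_eq, Set.mem_insert_iff, Prod.mk.injEq] at this
    tauto
  constructor
  · have k1 := key r (lam.part r + 1) h1 (by omega)
    have k2 := key r (lam.part r + 2) h1 (by omega)
    omega
  · intro a ha
    rcases Nat.eq_zero_or_pos a with rfl | hpos
    · rw [mu.zero_at_zero, lam.zero_at_zero]
    · have k1 := key a (lam.part a + 1) hpos (by omega)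
      have k2 := key a (lam.part a) hpos
      omega

theorem NoBad.step {e : ℕ} (he : 2 ≤ e) {i : ℕ} {lam mu : YPartition} (h : NoBad e lam)
    (hf : HatF (e + 1) i lam mu) : NoBad e mu := by
  obtain ⟨p, hp, hcells⟩ := hf
  have hpA : Addable lam p := hp.1.1.1
  have hpi : res (e + 1) p = i := hp.1.1.2
  obtain ⟨hm1, hm2⟩ := part_insert hpA hcells
  have hp2 := add_two hpA
  obtain ⟨r, b⟩ := p
  have hpA' := hpA
  obtain ⟨hr1, hr2, hr3⟩ := hpA'
  simp only at *
  intro a d t ha hd ht h1 h2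
  by_contra h3
  have het : 2 ≤ e * t := by nlinarith
  by_cases hra : r = a
  · subst hra
    rw [hm2 _ (by omega)] at h2 h3
    by_cases hc : lam.part (r + e * t) + 1 = d
    · have hsA : Addable lam (r + e * t, d) := ⟨by simp; omega, hc.symm, Or.inr h2⟩
      have hL : ladderIdx (e + 1) (r, b) = ladderIdx (e + 1) (r + e * t, d) := by
        have e1 := lidx e (r, b) hp2
        have e2 := lidx e (r + e * t, d) hd
        simp only at e1 e2
        have : b = d + t := by omega
        have : (ladderIdx (e + 1) (r, b) : ℤ) = ladderIdx (e + 1) (r + e * t, d) := by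
          rw [e1, e2, this]
          push_cast
          ring
        exact_mod_cast this
      refine cogood_aux hp (s := (r + e * t, d)) ⟨hsA, ?_⟩ ?_ ?_ ?_
      · rw [← hpi, res_ladder e _ _ hd hp2, hL]
        simp
      · exact Or.inr ⟨hL, by simp⟩
      · rintro (h4 | h4)
        · omega
        · have := h4.2
          simp only at this
          omega
      · rintro x hx hx1 hx2
        have hL' : ladderIdx (e + 1) x = ladderIdx (e + 1) (r + e * t, d) := by
          unfold LadderLE at hx1 hx2
          omega
        have := h.strict (by omega) hx.1 hsA hL'
        rcases hx2 with h4 | h4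
        · omega
        · omega
    · have := h r (d - 1) t ha (by omega) ht (by omega) (by omega)
      omega
  · rw [hm2 a (by omega)] at h1
    have h3' : ¬ d ≤ lam.part (a + e * t) := by
      by_cases hrc : a + e * t = r
      · rw [hrc] at h3 ⊢
        omega
      · rwa [hm2 _ hrc] at h3
    by_cases hrc : a + e * t - 1 = r
    · by_cases hd' : d ≤ lam.part r
      · exact h3' (h a d t ha hd ht h1 (by rwa [hrc]))
      have hbd : b = d := by
        rw [hrc] at h2
        omega
      subst hbd
      by_cases hup : a = 1 ∨ b + t + 1 ≤ lam.part (a - 1)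
      · have hsA : Addable lam (a, b + t + 1) := ⟨ha, by simp [h1], hup⟩
        have hLz : (ladderIdx (e + 1) (a, b + t + 1) : ℤ) =
            ladderIdx (e + 1) (r, b) + ((e + 1 : ℕ) : ℤ) := by
          have e1 := lidx e (r, b) hp2
          have e2 := lidx e (a, b + t + 1) (by simp)
          simp only at e1 e2
          rw [e1, e2]
          have : (r : ℤ) = a + e * t - 1 := by
            have : r + 1 = a + e * t := by omega
            have : ((r + 1 : ℕ) : ℤ) = (a + e * t : ℕ) := by rw [this]
            push_cast at this
            linarith
          rw [this]
          push_cast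
          ring
        refine cogood_aux hp (s := (a, b + t + 1)) ⟨hsA, ?_⟩ ?_ ?_ ?_
        · rw [← hpi, res_ladder e _ _ (by simp) hp2, hLz]
          simp
        · left
          omega
        · rintro (h4 | h4) <;> omega
        · rintro x hx hx1 hx2
          have hxc : ((e + 1 : ℕ) : ℤ) ∣
              (ladderIdx (e + 1) x : ℤ) - ladderIdx (e + 1) (r, b) := by
            rw [← res_ladder e _ _ (rem_two hx.1) hp2, hx.2, hpi]
          have hx12 : ladderIdx (e + 1) x = ladderIdx (e + 1) (r, b) ∨
              ladderIdx (e + 1) x = ladderIdx (e + 1) (a, b + t + 1) := by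
            by_contra hcon
            push Not at hcon
            have hlow : ladderIdx (e + 1) (r, b) < ladderIdx (e + 1) x := by
              unfold LadderLE at hx1
              omega
            have hhigh : ladderIdx (e + 1) x < ladderIdx (e + 1) (a, b + t + 1) := by
              unfold LadderLE at hx2
              omega
            have := Int.le_of_dvd (by omega) hxc
            omega
          rcases hx12 with hx3 | hx3
          · have hrx : r ≤ x.1 := by
              unfold LadderLE at hx1
              simp only at hx1
              omega
            obtain ⟨u, hu1, hu2⟩ := ladder_diff hp2 (rem_two hx.1) hx3.symm (by omega) hrx
            obtain ⟨f, g⟩ := x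
            obtain ⟨⟨hxR1, hxR2, hxR3⟩, -⟩ := hx
            simp only at *
            have hf1 : a + e * (t + u) - 1 = f := by
              rw [mul_add]
              omega
            have hf2 : a + e * (t + u) = f + 1 := by
              rw [mul_add]
              omega
            have := h a g (t + u) ha (by omega) (by omega) (by omega) (by rw [hf1]; omega)
            rw [hf2] at this
            omega
          · have := h.strict (by omega) hx.1 hsA hx3
            unfold LadderLE at hx2
            simp only at *
            omega
      · push Not at hup
        have hanti := lam.antitone (a - 1) a (by omega) (by omega)
        have e1 : a - 1 + e * t = r := by omega
        have := h (a - 1) b t (by omega) hd ht (by omega) (by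
          rw [e1]
          omega)
        rw [e1] at this
        omega
    · rw [hm2 _ hrc] at h2
      exact h3' (h a d t ha hd ht h1 h2)

theorem node_noBad {e : ℕ} (he : 2 ≤ e) {lam : YPartition} (h : LadderNode (e + 1) lam) :
    NoBad e lam := by
  unfold LadderNode at h
  induction h with
  | refl =>
    intro a d t _ _ _ h1
    simp only [emptyP] at h1
    omega
  | tail _ hbc ih =>
    obtain ⟨i, _, hf⟩ := hbc
    exact ih.step he hf

/-! ### Counting addable and removable boxes on ladders -/

open Classical in
theorem sum_shift (e : ℕ) (he : 1 ≤ e) (k s t : ℕ) (C : ℕ × ℕ → Prop)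
    (hC : ∀ q, C q → 1 ≤ q.1 ∧ 1 ≤ q.2) :
    (∑ p ∈ (Finset.Icc 1 k ×ˢ Finset.Icc 1 k).filter (fun p => ladderIdx (e + 1) p = k),
      if C (p.1 - s, p.2 - t) then 1 else 0) =
    {q | C q ∧ ladderIdx (e + 1) q + s + e * t = k}.ncard := by
  rw [← Finset.card_filter, ← Set.ncard_coe_finset]
  refine Set.ncard_congr (fun p _ => (p.1 - s, p.2 - t)) ?_ ?_ ?_
  · rintro ⟨a, b⟩ hp
    simp only [Finset.coe_filter, Finset.mem_filter, Finset.mem_product, Finset.mem_Icc,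
      Set.mem_ofPred_eq, ladderIdx, Nat.add_sub_cancel] at hp ⊢
    obtain ⟨⟨⟨⟨h1, h2⟩, h3, h4⟩, h5⟩, h6⟩ := hp
    refine ⟨h6, ?_⟩
    have := hC _ h6
    simp only at this
    have hb : b - 1 = (b - t - 1) + t := by omega
    rw [hb, mul_add] at h5
    omega
  · rintro ⟨a, b⟩ ⟨a', b'⟩ hp hp' heq
    simp only [Finset.coe_filter, Finset.mem_filter, Set.mem_ofPred_eq, Prod.mk.injEq]
      at hp hp' heq ⊢
    have h1 := hC _ hp.2
    have h2 := hC _ hp'.2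
    simp only at h1 h2
    omega
  · rintro ⟨a, b⟩ ⟨h1, h2⟩
    have h3 := hC _ h1
    simp only at h3
    refine ⟨(a + s, b + t), ?_, by simp⟩
    simp only [Finset.coe_filter, Finset.mem_filter, Finset.mem_product, Finset.mem_Icc,
      Set.mem_ofPred_eq, ladderIdx, Nat.add_sub_cancel] at h2 ⊢
    have hb : b + t - 1 = (b - 1) + t := by omega
    have hle : b - 1 + t ≤ e * (b - 1 + t) := Nat.le_mul_of_pos_left _ he
    rw [hb]
    rw [mul_add] at hle ⊢
    exact ⟨⟨⟨⟨by omega, by omega⟩, by omega, by omega⟩, by omega⟩, h1⟩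

open Classical in
theorem local_identity (μ : YPartition) (a b : ℕ) (ha : 1 ≤ a) (hb : 1 ≤ b) :
    (if Addable μ (a, b) then 1 else 0) + (if (a, b) ∈ μ.cells then 1 else 0) +
      (if (a - 1, b - 1) ∈ μ.cells then 1 else 0) + (if a = 1 ∨ b = 1 then 1 else 0) =
    (if Removable μ (a - 1, b - 1) then 1 else 0) + (if (a - 1, b) ∈ μ.cells then 1 else 0) +
      (if (a, b - 1) ∈ μ.cells then 1 else 0) +
      ((if a = 1 then 1 else 0) + (if b = 1 then 1 else 0)) := by
  obtain ⟨a, rfl⟩ : ∃ a', a = a' + 1 := ⟨a - 1, by omega⟩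
  obtain ⟨b, rfl⟩ : ∃ b', b = b' + 1 := ⟨b - 1, by omega⟩
  have hanti : 1 ≤ a → μ.part (a + 1) ≤ μ.part a := fun h => μ.antitone a (a + 1) h (by omega)
  simp only [Addable, Removable, cells, Set.mem_ofPred_eq, Nat.add_sub_cancel]
  rcases Nat.eq_zero_or_pos a with rfl | ha'
  · have := μ.zero_at_zero
    grind
  · have := hanti ha'
    grind

theorem ladder_identity (e : ℕ) (he : 1 ≤ e) (k : ℕ) : ∃ B B' : ℕ, ∀ μ : YPartition,
    {q | Addable μ q ∧ ladderIdx (e + 1) q = k}.ncard +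
      {q | q ∈ μ.cells ∧ ladderIdx (e + 1) q = k}.ncard +
      {q | q ∈ μ.cells ∧ ladderIdx (e + 1) q + 1 + e = k}.ncard + B =
    {q | Removable μ q ∧ ladderIdx (e + 1) q + 1 + e = k}.ncard +
      {q | q ∈ μ.cells ∧ ladderIdx (e + 1) q + 1 = k}.ncard +
      {q | q ∈ μ.cells ∧ ladderIdx (e + 1) q + e = k}.ncard + B' := by
  classical
  refine ⟨∑ p ∈ (Finset.Icc 1 k ×ˢ Finset.Icc 1 k).filter (fun p => ladderIdx (e + 1) p = k),
      if p.1 = 1 ∨ p.2 = 1 then 1 else 0,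
    ∑ p ∈ (Finset.Icc 1 k ×ˢ Finset.Icc 1 k).filter (fun p => ladderIdx (e + 1) p = k),
      ((if p.1 = 1 then 1 else 0) + (if p.2 = 1 then 1 else 0)), fun μ => ?_⟩
  have hA : ∀ q, Addable μ q → 1 ≤ q.1 ∧ 1 ≤ q.2 := fun q h => ⟨h.1, add_two h⟩
  have hR : ∀ q, Removable μ q → 1 ≤ q.1 ∧ 1 ≤ q.2 := fun q h => ⟨h.1, rem_two h⟩
  have hX : ∀ q, q ∈ μ.cells → 1 ≤ q.1 ∧ 1 ≤ q.2 := fun q h => ⟨h.1, h.2.1⟩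
  have a1 := sum_shift e he k 0 0 (Addable μ) hA
  have a2 := sum_shift e he k 0 0 (· ∈ μ.cells) hX
  have a3 := sum_shift e he k 1 1 (· ∈ μ.cells) hX
  have a4 := sum_shift e he k 1 1 (Removable μ) hR
  have a5 := sum_shift e he k 1 0 (· ∈ μ.cells) hX
  have a6 := sum_shift e he k 0 1 (· ∈ μ.cells) hX
  simp only [mul_zero, add_zero, mul_one, Nat.sub_zero] at a1 a2 a3 a4 a5 a6
  rw [← a1, ← a2, ← a3, ← a4, ← a5, ← a6]
  simp only [← Finset.sum_add_distrib]
  apply Finset.sum_congr rfl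
  rintro ⟨a, b⟩ hp
  simp only [Finset.mem_filter, Finset.mem_product, Finset.mem_Icc] at hp
  exact local_identity μ a b hp.1.1.1 hp.1.2.1

theorem count_shift {ℓ : ℕ} {lam rl : YPartition} (h : SameRegClass ℓ lam rl) (c k : ℕ) :
    {q | q ∈ lam.cells ∧ ladderIdx ℓ q + c = k}.ncard =
    {q | q ∈ rl.cells ∧ ladderIdx ℓ q + c = k}.ncard := by
  by_cases hck : c ≤ k
  · have key : ∀ μ : YPartition, {q | q ∈ μ.cells ∧ ladderIdx ℓ q + c = k} =
        μ.cells ∩ {p | ladderIdx ℓ p = k - c} := by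
      intro μ
      ext q
      simp only [Set.mem_ofPred_eq, Set.mem_inter_iff]
      refine and_congr_right fun _ => ?_
      omega
    rw [key, key]
    exact h (k - c)
  · have key : ∀ μ : YPartition, {q | q ∈ μ.cells ∧ ladderIdx ℓ q + c = k} = ∅ := by
      intro μ
      rw [Set.eq_empty_iff_forall_notMem]
      rintro q ⟨_, h2⟩
      omega
    rw [key, key]

theorem balance_nat {e : ℕ} (he : 1 ≤ e) {lam rl : YPartition}
    (h : SameRegClass (e + 1) lam rl) (k : ℕ) :
    {q | Addable lam q ∧ ladderIdx (e + 1) q = k}.ncard +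
      {q | Removable rl q ∧ ladderIdx (e + 1) q + (e + 1) = k}.ncard =
    {q | Addable rl q ∧ ladderIdx (e + 1) q = k}.ncard +
      {q | Removable lam q ∧ ladderIdx (e + 1) q + (e + 1) = k}.ncard := by
  obtain ⟨B, B', hB⟩ := ladder_identity e he k
  have h1 := hB lam
  have h2 := hB rl
  have c1 := count_shift h 0 k
  have c2 := count_shift h (1 + e) k
  have c3 := count_shift h 1 k
  have c4 := count_shift h e k
  simp only [add_zero, ← add_assoc] at c1 c2
  have hcomm : ∀ q, ladderIdx (e + 1) q + (e + 1) = ladderIdx (e + 1) q + 1 + e := by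
    intro q
    omega
  simp only [hcomm]
  omega

theorem ncard_interval {T : Set (ℕ × ℕ)} (hT : T.Finite) (f : ℕ × ℕ → ℤ) (x y : ℤ) :
    (T ∩ {s | x < f s ∧ f s ≤ y}).ncard = ∑ j ∈ Finset.Ioc x y, (T ∩ {s | f s = j}).ncard := by
  classical
  have hfin : (T ∩ {s | x < f s ∧ f s ≤ y}).Finite := hT.subset Set.inter_subset_left
  rw [Set.ncard_eq_toFinset_card _ hfin]
  rw [Finset.card_eq_sum_card_fiberwise (f := f) (t := Finset.Ioc x y)]
  · apply Finset.sum_congr rfl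
    intro j hj
    rw [Finset.mem_Ioc] at hj
    rw [← Set.ncard_coe_finset]
    congr 1
    ext s
    simp only [Finset.coe_filter, Set.Finite.mem_toFinset, Set.mem_inter_iff,
      Set.mem_ofPred_eq]
    constructor
    · rintro ⟨⟨h1, _⟩, h2⟩
      exact ⟨h1, h2⟩
    · rintro ⟨h1, h2⟩
      exact ⟨⟨h1, by omega, by omega⟩, h2⟩
  · intro s hs
    simp only [Set.Finite.coe_toFinset, Set.mem_inter_iff, Set.mem_ofPred_eq] at hs
    simpa using hs.2

theorem finite_remres (ℓ i : ℕ) (μ : YPartition) : (RemovableRes ℓ i μ).Finite :=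
  (finite_rem μ).subset fun _ hx => hx.1

theorem finite_addres (ℓ i : ℕ) (μ : YPartition) : (AddableRes ℓ i μ).Finite :=
  (finite_add μ).subset fun _ hx => hx.1

theorem cong_of_mem {e i k : ℕ} (hi : i = res (e + 1) (k, 1)) {μ : YPartition} {p : ℕ × ℕ}
    (hp : p ∈ RemovableRes (e + 1) i μ ∪ AddableRes (e + 1) i μ) :
    ((e + 1 : ℕ) : ℤ) ∣ (ladderIdx (e + 1) p : ℤ) - k := by
  have hp2 : 1 ≤ p.2 := hp.elim (fun h => rem_two h.1) (fun h => add_two h.1)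
  have hr : res (e + 1) p = res (e + 1) (k, 1) := by
    rw [← hi]
    exact hp.elim (fun h => h.2) (fun h => h.2)
  rw [res_ladder e _ _ hp2 le_rfl] at hr
  simpa [ladderIdx] using hr

theorem balance_int {e : ℕ} (he : 1 ≤ e) {lam rl : YPartition}
    (h : SameRegClass (e + 1) lam rl) {i k : ℕ} (hi : i = res (e + 1) (k, 1)) (j : ℤ) :
    (AddableRes (e + 1) i lam ∩ {s | (ladderIdx (e + 1) s : ℤ) = j}).ncard +
    (RemovableRes (e + 1) i rl ∩
      {s | (ladderIdx (e + 1) s : ℤ) + ((e + 1 : ℕ) : ℤ) = j}).ncard =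
    (AddableRes (e + 1) i rl ∩ {s | (ladderIdx (e + 1) s : ℤ) = j}).ncard +
    (RemovableRes (e + 1) i lam ∩
      {s | (ladderIdx (e + 1) s : ℤ) + ((e + 1 : ℕ) : ℤ) = j}).ncard := by
  by_cases hj : 0 ≤ j ∧ ((e + 1 : ℕ) : ℤ) ∣ j - k
  · obtain ⟨hj0, hjk⟩ := hj
    lift j to ℕ using hj0
    have hres : ∀ q : ℕ × ℕ, 1 ≤ q.2 →
        ((e + 1 : ℕ) : ℤ) ∣ (ladderIdx (e + 1) q : ℤ) - j → res (e + 1) q = i := by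
      intro q hq hd
      rw [hi, res_ladder e _ _ hq le_rfl]
      have := dvd_add hd hjk
      simpa [ladderIdx] using this
    have kA : ∀ μ : YPartition,
        AddableRes (e + 1) i μ ∩ {s | (ladderIdx (e + 1) s : ℤ) = (j : ℕ)} =
        {q | Addable μ q ∧ ladderIdx (e + 1) q = j} := by
      intro μ
      ext q
      constructor
      · rintro ⟨h1, h2⟩
        exact ⟨h1.1, by exact_mod_cast h2⟩
      · rintro ⟨h1, h2⟩
        exact ⟨⟨h1, hres q (add_two h1) (by simp [h2])⟩, by exact_mod_cast h2⟩
    have kR : ∀ μ : YPartition, RemovableRes (e + 1) i μ ∩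
        {s | (ladderIdx (e + 1) s : ℤ) + ((e + 1 : ℕ) : ℤ) = (j : ℕ)} =
        {q | Removable μ q ∧ ladderIdx (e + 1) q + (e + 1) = j} := by
      intro μ
      ext q
      constructor
      · rintro ⟨h1, h2⟩
        exact ⟨h1.1, by exact_mod_cast h2⟩
      · rintro ⟨h1, h2⟩
        refine ⟨⟨h1, hres q (rem_two h1) ?_⟩, by exact_mod_cast h2⟩
        rw [← h2]
        push_cast
        refine ⟨-1, by ring⟩
    rw [kA, kA, kR, kR]
    exact balance_nat he h j
  · have kA : ∀ μ : YPartition,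
        AddableRes (e + 1) i μ ∩ {s | (ladderIdx (e + 1) s : ℤ) = j} = ∅ := by
      intro μ
      rw [Set.eq_empty_iff_forall_notMem]
      rintro q ⟨h1, h2⟩
      have h3 := cong_of_mem hi (Or.inr h1 : q ∈ RemovableRes (e + 1) i μ ∪ _)
      simp only [Set.mem_ofPred_eq] at h2
      rw [h2] at h3
      exact hj ⟨by omega, h3⟩
    have kR : ∀ μ : YPartition, RemovableRes (e + 1) i μ ∩
        {s | (ladderIdx (e + 1) s : ℤ) + ((e + 1 : ℕ) : ℤ) = j} = ∅ := by
      intro μ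
      rw [Set.eq_empty_iff_forall_notMem]
      rintro q ⟨h1, h2⟩
      have h3 := cong_of_mem hi (Or.inl h1 : q ∈ _ ∪ AddableRes (e + 1) i μ)
      simp only [Set.mem_ofPred_eq] at h2
      refine hj ⟨by omega, ?_⟩
      have h4 := dvd_add h3 (dvd_refl _)
      have h5 : j - k = (ladderIdx (e + 1) q : ℤ) - k + ((e + 1 : ℕ) : ℤ) := by linarith
      rw [h5]
      exact h4
    rw [kA, kA, kR, kR]

theorem balance_interval {e : ℕ} (he : 1 ≤ e) {lam rl : YPartition}
    (h : SameRegClass (e + 1) lam rl) {i k : ℕ} (hi : i = res (e + 1) (k, 1)) (x y : ℤ) :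
    (AddableRes (e + 1) i lam ∩
      {s | x < (ladderIdx (e + 1) s : ℤ) ∧ (ladderIdx (e + 1) s : ℤ) ≤ y}).ncard +
    (RemovableRes (e + 1) i rl ∩ {s | x < (ladderIdx (e + 1) s : ℤ) + ((e + 1 : ℕ) : ℤ) ∧
      (ladderIdx (e + 1) s : ℤ) + ((e + 1 : ℕ) : ℤ) ≤ y}).ncard =
    (AddableRes (e + 1) i rl ∩
      {s | x < (ladderIdx (e + 1) s : ℤ) ∧ (ladderIdx (e + 1) s : ℤ) ≤ y}).ncard +
    (RemovableRes (e + 1) i lam ∩ {s | x < (ladderIdx (e + 1) s : ℤ) + ((e + 1 : ℕ) : ℤ) ∧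
      (ladderIdx (e + 1) s : ℤ) + ((e + 1 : ℕ) : ℤ) ≤ y}).ncard := by
  rw [ncard_interval (finite_addres _ _ _) (fun s => (ladderIdx (e + 1) s : ℤ)),
    ncard_interval (finite_addres _ _ _) (fun s => (ladderIdx (e + 1) s : ℤ)),
    ncard_interval (finite_remres _ _ _)
      (fun s => (ladderIdx (e + 1) s : ℤ) + ((e + 1 : ℕ) : ℤ)),
    ncard_interval (finite_remres _ _ _)
      (fun s => (ladderIdx (e + 1) s : ℤ) + ((e + 1 : ℕ) : ℤ)),
    ← Finset.sum_add_distrib, ← Finset.sum_add_distrib]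
  exact Finset.sum_congr rfl fun j _ => balance_int he h hi j

/-- On removable boxes of the right residue class, half-open intervals shift by `ℓ`. -/
theorem rem_shift {e i k : ℕ} (hi : i = res (e + 1) (k, 1)) (μ : YPartition) (x w : ℤ)
    (hx : ((e + 1 : ℕ) : ℤ) ∣ x - k) :
    RemovableRes (e + 1) i μ ∩ {s | x ≤ (ladderIdx (e + 1) s : ℤ) ∧
      (ladderIdx (e + 1) s : ℤ) < x + ((e + 1 : ℕ) : ℤ) * w} =
    RemovableRes (e + 1) i μ ∩ {s | x < (ladderIdx (e + 1) s : ℤ) + ((e + 1 : ℕ) : ℤ) ∧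
      (ladderIdx (e + 1) s : ℤ) + ((e + 1 : ℕ) : ℤ) ≤ x + ((e + 1 : ℕ) : ℤ) * w} := by
  ext s
  simp only [Set.mem_inter_iff, Set.mem_ofPred_eq]
  refine and_congr_right fun hs => ?_
  have h1 := cong_of_mem hi (Or.inl hs : s ∈ _ ∪ AddableRes (e + 1) i μ)
  obtain ⟨z, hz⟩ : ((e + 1 : ℕ) : ℤ) ∣ (ladderIdx (e + 1) s : ℤ) - x := by
    have h2 := dvd_sub h1 hx
    have h3 : (ladderIdx (e + 1) s : ℤ) - x = (ladderIdx (e + 1) s : ℤ) - k - (x - k) := by ring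
    rw [h3]
    exact h2
  have hL : (ladderIdx (e + 1) s : ℤ) = x + ((e + 1 : ℕ) : ℤ) * z := by omega
  rw [hL]
  have hn : (0 : ℤ) < ((e + 1 : ℕ) : ℤ) := by omega
  generalize ((e + 1 : ℕ) : ℤ) = n at *
  constructor
  · rintro ⟨h2, h3⟩
    have h4 : 0 ≤ z := by
      by_contra hcon
      nlinarith
    have h5 : z < w := by
      by_contra hcon
      nlinarith
    constructor <;> nlinarith
  · rintro ⟨h2, h3⟩
    have h4 : 0 ≤ z := by
      by_contra hcon
      nlinarith
    have h5 : z < w := by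
      by_contra hcon
      nlinarith
    constructor <;> nlinarith

/-! ### The two signatures -/

theorem SigSys.flip {le : ℕ × ℕ → ℕ × ℕ → Prop} {Rem Add : Set (ℕ × ℕ)} {L : ℕ × ℕ → ℤ}
    {n k : ℤ} (S : SigSys le Rem Add L n k)
    (hanti : ∀ p ∈ Add, ∀ q ∈ Add, L p = L q → le p q → le q p → p = q) :
    SigSys (fun p q => le q p) Add Rem (fun p => - L p) n (-k) where
  npos := S.npos
  finR := S.finA
  finA := S.finR
  tot := fun p q => S.tot q p
  trans := fun p q r h1 h2 => S.trans _ _ _ h2 h1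
  lvl := fun p hp q hq h => S.lvl q hq.symm p hp.symm (by linarith)
  strict := fun p hp q hq h => S.strict q hq p hp (by linarith)
  anti := fun p hp q hq h h1 h2 => hanti p hp q hq (by linarith) h2 h1
  cong := fun p hp => by
    have h1 := (S.cong p hp.symm).neg_right
    have h2 : - L p - -k = -(L p - k) := by ring
    rw [h2]
    exact h1

theorem conormal_flip (le : ℕ × ℕ → ℕ × ℕ → Prop) (Rem Add : Set (ℕ × ℕ)) (q : ℕ × ℕ) :
    ConormalIn le Rem Add q ↔ NormalIn (fun p q => le q p) Add Rem q := by
  unfold ConormalIn NormalIn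
  rw [Set.union_comm]
  simp only [and_comm]

theorem same_pos {e : ℕ} (he : 1 ≤ e) {p q : ℕ × ℕ} (hp : 1 ≤ p.2) (hq : 1 ≤ q.2)
    (h : ladderIdx (e + 1) p = ladderIdx (e + 1) q) (h1 : p.1 = q.1) : p = q := by
  obtain ⟨t, h2, h3⟩ := ladder_diff hp hq h he h1.le
  have : e * t = 0 := by omega
  rcases Nat.mul_eq_zero.1 this with h4 | h4
  · omega
  · exact Prod.ext h1 (by omega)

theorem sys_ladder {e : ℕ} (he : 1 ≤ e) {i k : ℕ} (hi : i = res (e + 1) (k, 1))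
    {lam : YPartition} (h : NoBad e lam) :
    SigSys (LadderLE (e + 1)) (RemovableRes (e + 1) i lam) (AddableRes (e + 1) i lam)
      (fun p => (ladderIdx (e + 1) p : ℤ)) ((e + 1 : ℕ) : ℤ) k where
  npos := by omega
  finR := finite_remres _ _ _
  finA := finite_addres _ _ _
  tot := by
    intro p q
    unfold LadderLE
    omega
  trans := by
    intro p q r
    unfold LadderLE
    omega
  lvl := by
    intro p _ q _
    unfold LadderLE
    omega
  strict := by
    intro p hp q hq hL
    have := h.strict he hq.1 hp.1 (by exact_mod_cast hL.symm)
    unfold LadderLE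
    omega
  anti := by
    intro p hp q hq hL h1 h2
    unfold LadderLE at h1 h2
    exact same_pos he (rem_two hp.1) (rem_two hq.1) (by exact_mod_cast hL) (by omega)
  cong := fun p hp => cong_of_mem hi hp

theorem row_order {e : ℕ} (he : 1 ≤ e) {i k : ℕ} (hi : i = res (e + 1) (k, 1))
    {rl : YPartition} (h : TopJustified (e + 1) rl) {p q : ℕ × ℕ}
    (hp : p ∈ RemovableRes (e + 1) i rl ∪ AddableRes (e + 1) i rl)
    (hq : q ∈ RemovableRes (e + 1) i rl ∪ AddableRes (e + 1) i rl)
    (hL : ladderIdx (e + 1) p < ladderIdx (e + 1) q) : q.1 < p.1 := by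
  by_contra hcon
  have hp1 : 1 ≤ p.1 := hp.elim (fun h => h.1.1) (fun h => h.1.1)
  have hp2 : 1 ≤ p.2 := hp.elim (fun h => rem_two h.1) (fun h => add_two h.1)
  have hq2 : 1 ≤ q.2 := hq.elim (fun h => rem_two h.1) (fun h => add_two h.1)
  have hdiff : (ladderIdx (e + 1) p : ℤ) + ((e + 1 : ℕ) : ℤ) ≤ ladderIdx (e + 1) q := by
    have h1 := cong_of_mem hi hp
    have h2 := cong_of_mem hi hq
    have h3 := dvd_sub h2 h1
    have := Int.le_of_dvd (by omega) h3
    omega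
  rw [lidx e p hp2, lidx e q hq2] at hdiff
  have hpp : p.2 = rl.part p.1 ∨ p.2 = rl.part p.1 + 1 :=
    hp.elim (fun h => Or.inl h.1.2.1) (fun h => Or.inr h.1.2.1)
  have hqq : q.2 = rl.part q.1 ∨ q.2 = rl.part q.1 + 1 :=
    hq.elim (fun h => Or.inl h.1.2.1) (fun h => Or.inr h.1.2.1)
  have hpe : p.1 < q.1 := by
    rcases (show p.1 ≤ q.1 by omega).eq_or_lt with h1 | h1
    · exfalso
      rw [h1] at hdiff hpp
      have : (q.2 : ℤ) ≤ p.2 + 1 := by omega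
      have h5 : (e : ℤ) * (q.2 - 1) ≤ e * (p.2 + 1 - 1) := by
        apply mul_le_mul_of_nonneg_left <;> omega
      push_cast at hdiff
      nlinarith
    · exact h1
  -- the box directly below `p` is not in the diagram
  have hbelow : ∀ c, p.1 < c → ¬ p.2 ≤ rl.part c := by
    intro c hc
    have h1 := rl.antitone (p.1 + 1) c (by omega) (by omega)
    have h2 := rl.antitone p.1 c hp1 (by omega)
    rcases hp with h3 | h3
    · have := h3.1.2.2
      omega
    · have := h3.1.2.1
      omega
  -- occupied box in column `q.2`, row `q.1` or `q.1 - 1`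
  have hocc : q.2 ≤ rl.part (q.1 - 1) := by
    rcases hq with h3 | h3
    · have h4 := rl.antitone (q.1 - 1) q.1 (by omega) (by omega)
      have := h3.1.2.1
      omega
    · have := h3.1.2.2
      omega
  have hqp : q.2 ≤ p.2 := by
    by_contra hcon2
    have h4 := rl.antitone p.1 (q.1 - 1) hp1 (by omega)
    rcases (show p.1 ≤ q.1 - 1 by omega).eq_or_lt with h5 | h5
    · rcases hp with h3 | h3
      · have := h3.1.2.1
        omega
      · have h6 := h3.1.2.1
        omega
    · exact hbelow _ h5 (by omega)
  obtain ⟨t, ht⟩ := Nat.exists_eq_add_of_le hqp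
  have hrow : p.1 + (e + 1) + e * t ≤ q.1 := by
    rw [ht] at hdiff
    push_cast at hdiff
    have : (p.1 : ℤ) + (e + 1) + e * t ≤ q.1 := by nlinarith
    exact_mod_cast this
  have hmem : (q.1 - 1 - e * t, p.2) ∈ rl.cells := by
    rcases Nat.eq_zero_or_pos t with rfl | htpos
    · refine ⟨by simp; omega, hp2, ?_⟩
      simp only [mul_zero, Nat.sub_zero]
      omega
    · have het : 1 ≤ e * t := Nat.mul_pos he htpos
      refine h (q.1 - 1, q.2) ⟨by simp; omega, hq2, hocc⟩ (q.1 - 1 - e * t, p.2)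
        (by simp; omega) hp2 ?_ (by simp; omega)
      simp only [ladderIdx, Nat.add_sub_cancel]
      rw [ht, show q.2 + t - 1 = (q.2 - 1) + t by omega, mul_add]
      omega
  exact hbelow _ (by omega) hmem.2.2

theorem sys_row {e : ℕ} (he : 1 ≤ e) {i k : ℕ} (hi : i = res (e + 1) (k, 1))
    {rl : YPartition} (h : TopJustified (e + 1) rl) :
    SigSys RowLE (RemovableRes (e + 1) i rl) (AddableRes (e + 1) i rl)
      (fun p => (ladderIdx (e + 1) p : ℤ)) ((e + 1 : ℕ) : ℤ) k where
  npos := by omega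
  finR := finite_remres _ _ _
  finA := finite_addres _ _ _
  tot := by
    intro p q
    unfold RowLE
    omega
  trans := by
    intro p q r
    unfold RowLE
    omega
  lvl := by
    intro p hp q hq hL
    have := row_order he hi h hp hq (by exact_mod_cast hL)
    unfold RowLE
    omega
  strict := by
    intro p hp q hq hL hle
    unfold RowLE at hle
    have hL' : ladderIdx (e + 1) p = ladderIdx (e + 1) q := by exact_mod_cast hL
    have hp2 := add_two hp.1
    have hqc : q ∈ rl.cells := ⟨hq.1.1, rem_two hq.1, hq.1.2.1.le⟩
    have hpc : p ∉ rl.cells := fun hc => by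
      have h1 := hc.2.2
      have h2 := hp.1.2.1
      omega
    rcases hle.eq_or_lt with h1 | h1
    · have := same_pos he hp2 (rem_two hq.1) hL' h1
      rw [this] at hpc
      exact hpc hqc
    · exact hpc (h q hqc p hp.1.1 hp2 hL' h1)
  anti := by
    intro p hp q hq hL h1 h2
    unfold RowLE at h1 h2
    exact same_pos he (rem_two hp.1) (rem_two hq.1) (by exact_mod_cast hL) (by omega)
  cong := fun p hp => cong_of_mem hi hp

theorem normal_counts {e : ℕ} (he : 2 ≤ e) {lam rl : YPartition}
    (hnode : LadderNode (e + 1) lam) (hreg : IsRegularization (e + 1) lam rl)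
    {i k : ℕ} (hi : i = res (e + 1) (k, 1)) :
    {p : ℕ × ℕ | LadderNormal (e + 1) i lam p ∧ ladderIdx (e + 1) p = k}.ncard =
      {p : ℕ × ℕ | ClassNormal (e + 1) i rl p ∧ ladderIdx (e + 1) p = k}.ncard := by
  have h1 := (sys_ladder (e := e) (by omega) hi (node_noBad he hnode)).count
  have h2 := (sys_row (e := e) (by omega) hi hreg.2).count
  simp only [Nat.cast_inj] at h1 h2
  refine h1.trans (Eq.trans ?_ h2.symm)
  congr 1
  ext j
  refine and_congr_right fun _ => forall_congr' fun v => forall_congr' fun _ => ?_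
  rw [rem_shift hi lam k v (by simp), rem_shift hi rl k v (by simp)]
  have := balance_interval (by omega) hreg.1 hi k (k + ((e + 1 : ℕ) : ℤ) * v)
  omega

theorem conormal_counts {e : ℕ} (he : 2 ≤ e) {lam rl : YPartition}
    (hnode : LadderNode (e + 1) lam) (hreg : IsRegularization (e + 1) lam rl)
    {i k : ℕ} (hi : i = res (e + 1) (k, 1)) :
    {p : ℕ × ℕ | LadderConormal (e + 1) i lam p ∧ ladderIdx (e + 1) p = k}.ncard =
      {p : ℕ × ℕ | ClassConormal (e + 1) i rl p ∧ ladderIdx (e + 1) p = k}.ncard := by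
  have h1 := ((sys_ladder (e := e) (by omega) hi (node_noBad he hnode)).flip (by
    intro p hp q hq hL h1 h2
    unfold LadderLE at h1 h2
    have hL' : ladderIdx (e + 1) p = ladderIdx (e + 1) q := by exact_mod_cast hL
    have hrow : p.1 = q.1 := by omega
    exact same_pos (by omega) (add_two hp.1) (add_two hq.1) hL' hrow)).count
  have h2 := ((sys_row (e := e) (by omega) hi hreg.2).flip (by
    intro p hp q hq hL h1 h2
    unfold RowLE at h1 h2
    have hL' : ladderIdx (e + 1) p = ladderIdx (e + 1) q := by exact_mod_cast hL
    have hrow : p.1 = q.1 := by omega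
    exact same_pos (by omega) (add_two hp.1) (add_two hq.1) hL' hrow)).count
  simp only [neg_inj, Nat.cast_inj, ← conormal_flip] at h1 h2
  refine h1.trans (Eq.trans ?_ h2.symm)
  congr 1
  ext j
  refine and_congr_right fun _ => forall_congr' fun v => forall_congr' fun _ => ?_
  have key := balance_interval (by omega) hreg.1 hi
    (k - ((e + 1 : ℕ) : ℤ) * v) (k - ((e + 1 : ℕ) : ℤ) * v + ((e + 1 : ℕ) : ℤ) * v)
  have hd : ((e + 1 : ℕ) : ℤ) ∣ (k - ((e + 1 : ℕ) : ℤ) * v) - k := ⟨-v, by ring⟩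
  rw [← rem_shift hi lam _ v hd, ← rem_shift hi rl _ v hd] at key
  have setA : ∀ T : Set (ℕ × ℕ),
      T ∩ {s | -(k : ℤ) ≤ -(ladderIdx (e + 1) s : ℤ) ∧
        -(ladderIdx (e + 1) s : ℤ) < -(k : ℤ) + ((e + 1 : ℕ) : ℤ) * v} =
      T ∩ {s | k - ((e + 1 : ℕ) : ℤ) * v < (ladderIdx (e + 1) s : ℤ) ∧
        (ladderIdx (e + 1) s : ℤ) ≤ k - ((e + 1 : ℕ) : ℤ) * v + ((e + 1 : ℕ) : ℤ) * v} := by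
    intro T
    ext s
    simp only [Set.mem_inter_iff, Set.mem_ofPred_eq]
    refine and_congr_right fun _ => ?_
    omega
  have setR : ∀ T : Set (ℕ × ℕ),
      T ∩ {s | -(k : ℤ) < -(ladderIdx (e + 1) s : ℤ) ∧
        -(ladderIdx (e + 1) s : ℤ) ≤ -(k : ℤ) + ((e + 1 : ℕ) : ℤ) * v} =
      T ∩ {s | k - ((e + 1 : ℕ) : ℤ) * v ≤ (ladderIdx (e + 1) s : ℤ) ∧
        (ladderIdx (e + 1) s : ℤ) < k - ((e + 1 : ℕ) : ℤ) * v + ((e + 1 : ℕ) : ℤ) * v} := by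
    intro T
    ext s
    simp only [Set.mem_inter_iff, Set.mem_ofPred_eq]
    refine and_congr_right fun _ => ?_
    omega
  rw [setA, setA, setR, setR]
  omega

theorem transfer {P Q : ℕ × ℕ → Prop} {L : ℕ × ℕ → ℕ} {k : ℕ}
    (hfin : {p | P p ∧ L p = k}.Finite)
    (h : {p | P p ∧ L p = k}.ncard = {p | Q p ∧ L p = k}.ncard) {p : ℕ × ℕ} (hp : P p)
    (hk : L p = k) : ∃ q, Q q ∧ L q = k := by
  have h1 : 0 < {p | P p ∧ L p = k}.ncard := (Set.ncard_pos hfin).2 ⟨p, hp, hk⟩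
  rw [h] at h1
  exact Set.nonempty_of_ncard_ne_zero h1.ne'

theorem res_of_idx {e : ℕ} {p : ℕ × ℕ} (hp : 1 ≤ p.2) :
    res (e + 1) p = res (e + 1) (ladderIdx (e + 1) p, 1) := by
  rw [res_ladder e _ _ hp le_rfl]
  simp [ladderIdx]

/-- for a node `λ` of `B(Λ₀)^L` with regularization `Rλ = rl`, and `k ≥ 1`
with `i` the residue of the `k`-th ladder: the number of ladder (co)normal `i`-boxes of `λ`
on the `k`-th ladder equals the number of (co)normal `i`-boxes of `Rλ` on the `k`-th
ladder; in particular the ladder (co)good `i`-box of `λ` lies on the same ladder as the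
(co)good `i`-box of `Rλ`. -/
theorem statement17 (ℓ : ℕ) (hℓ : 2 < ℓ) (lam rl : YPartition)
    (hnode : LadderNode ℓ lam) (hreg : IsRegularization ℓ lam rl)
    (k : ℕ) (hk : 1 ≤ k) (i : ℕ) (hi : i = res ℓ (k, 1)) :
    {p : ℕ × ℕ | LadderNormal ℓ i lam p ∧ ladderIdx ℓ p = k}.ncard =
      {p : ℕ × ℕ | ClassNormal ℓ i rl p ∧ ladderIdx ℓ p = k}.ncard ∧
    {p : ℕ × ℕ | LadderConormal ℓ i lam p ∧ ladderIdx ℓ p = k}.ncard =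
      {p : ℕ × ℕ | ClassConormal ℓ i rl p ∧ ladderIdx ℓ p = k}.ncard ∧
    (∀ p q : ℕ × ℕ, LadderGood ℓ i lam p → ClassGood ℓ i rl q →
      ladderIdx ℓ p = ladderIdx ℓ q) ∧
    (∀ p q : ℕ × ℕ, LadderCogood ℓ i lam p → ClassCogood ℓ i rl q →
      ladderIdx ℓ p = ladderIdx ℓ q) := by
  obtain ⟨e, rfl⟩ : ∃ e, ℓ = e + 1 := ⟨ℓ - 1, by omega⟩
  have he : 2 ≤ e := by omega
  refine ⟨normal_counts he hnode hreg hi, conormal_counts he hnode hreg hi, ?_, ?_⟩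
  · intro p q hp hq
    have hpi := hp.1.1.2.symm.trans (res_of_idx (rem_two hp.1.1.1))
    have hqi := hq.1.1.2.symm.trans (res_of_idx (rem_two hq.1.1.1))
    obtain ⟨q', hq', hq'L⟩ := transfer
      ((finite_remres (e + 1) i lam).subset fun x hx => hx.1.1)
      (normal_counts he hnode hreg hpi) hp.1 rfl
    obtain ⟨p', hp', hp'L⟩ := transfer
      ((finite_remres (e + 1) i rl).subset fun x hx => hx.1.1)
      (normal_counts he hnode hreg hqi).symm hq.1 rfl
    have h1 := hp.2 p' hp'
    have h2 := hq.2 q' hq'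
    have h3 : ¬ ladderIdx (e + 1) q' < ladderIdx (e + 1) q := fun h => by
      have := row_order (by omega) hi hreg.2 (Or.inl hq'.1) (Or.inl hq.1.1) h
      unfold RowLE at h2
      omega
    unfold LadderLE at h1
    omega
  · intro p q hp hq
    have hpi := hp.1.1.2.symm.trans (res_of_idx (add_two hp.1.1.1))
    have hqi := hq.1.1.2.symm.trans (res_of_idx (add_two hq.1.1.1))
    obtain ⟨q', hq', hq'L⟩ := transfer
      ((finite_addres (e + 1) i lam).subset fun x hx => hx.1.1)
      (conormal_counts he hnode hreg hpi) hp.1 rfl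
    obtain ⟨p', hp', hp'L⟩ := transfer
      ((finite_addres (e + 1) i rl).subset fun x hx => hx.1.1)
      (conormal_counts he hnode hreg hqi).symm hq.1 rfl
    have h1 := hp.2 p' hp'
    have h2 := hq.2 q' hq'
    have h3 : ¬ ladderIdx (e + 1) q < ladderIdx (e + 1) q' := fun h => by
      have := row_order (by omega) hi hreg.2 (Or.inr hq.1.1) (Or.inr hq'.1) h
      unfold RowLE at h2
      omega
    unfold LadderLE at h1
    omega
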